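/- Let n ≥ 2 be a natural number, let δ, ε, r₀ be positive real numbers, let b > 1, and let C be a real number with C > (4δ + (n + 4δ(ε+1) − 1)/ε)·(b−1)·(r₀+ε)^{b−1}. Then there do not exist functions m, φ : ℝ → ℝ such that φ is differentiable on [ε, ∞) with φ'(t) ≤ −m(t)²/(n−1) − C·(r₀+t)^{−b} for all t ≥ ε, φ(t) ≥ −4δ for all t ≥ ε, and φ(ε) ≤ (n + 4δ(ε+1) − 1)/ε. -/

import Mathlib

open MeasureTheory Set

/-- Analytic core of Corollary 1.6 for `b > 1`: the Riccati inequality with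
`h(t) = (r₀+t)^{−b}` and the comparison bounds under `|f| ≤ δ(d+1)` contradict
`C > (4δ + (n + 4δ(ε+1) − 1)/ε)·(b−1)·(r₀+ε)^{b−1}`. -/
theorem stmt_4 (n : ℕ) (hn : 2 ≤ n) (δ ε r₀ b C : ℝ) (hδ : 0 < δ) (hε : 0 < ε)
    (hr₀ : 0 < r₀) (hb : 1 < b)
    (hC : (4 * δ + ((n : ℝ) + 4 * δ * (ε + 1) - 1) / ε) * (b - 1) * (r₀ + ε) ^ (b - 1) < C) :
    ¬ ∃ m φ φ' : ℝ → ℝ,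
      (∀ t ∈ Ici ε, HasDerivWithinAt φ (φ' t) (Ici ε) t) ∧
      (∀ t, ε ≤ t → φ' t ≤ -(m t) ^ 2 / ((n : ℝ) - 1) - C * (r₀ + t) ^ (-b)) ∧
      (∀ t, ε ≤ t → -(4 * δ) ≤ φ t) ∧
      φ ε ≤ ((n : ℝ) + 4 * δ * (ε + 1) - 1) / ε := by
  rintro ⟨m, φ, φ', hd, hle, hlow, hup⟩
  have hb1 : 0 < b - 1 := by linarith
  have hn1 : (0 : ℝ) < (n : ℝ) - 1 := by
    have : (2 : ℝ) ≤ n := by exact_mod_cast hn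
    linarith
  have hG : ∀ t ∈ Ici ε, HasDerivWithinAt
      (fun t => φ t - C / (b - 1) * (r₀ + t) ^ (-(b - 1)))
      (φ' t + C * (r₀ + t) ^ (-b)) (Ici ε) t := by
    intro t ht
    have ht' : ε ≤ t := ht
    have hpos : 0 < r₀ + t := by linarith
    have h1 : HasDerivAt (fun t : ℝ => r₀ + t) 1 t := (hasDerivAt_id t).const_add r₀
    have h2 := ((h1.rpow_const (p := -(b - 1)) (Or.inl hpos.ne')).const_mul (C / (b - 1)))
    refine ((hd t ht).sub h2.hasDerivWithinAt).congr_deriv ?_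
    have he : -(b - 1) - 1 = -b := by ring
    rw [he]
    field_simp
    ring
  have hanti : AntitoneOn (fun t => φ t - C / (b - 1) * (r₀ + t) ^ (-(b - 1))) (Ici ε) := by
    refine antitoneOn_of_hasDerivWithinAt_nonpos (convex_Ici ε)
      (fun t ht => (hG t ht).continuousWithinAt)
      (fun t ht => (hG t (interior_subset ht)).mono interior_subset) ?_
    intro t ht
    have h1 := hle t (interior_subset ht)
    have h2 : -(m t) ^ 2 / ((n : ℝ) - 1) ≤ 0 :=
      div_nonpos_of_nonpos_of_nonneg (by nlinarith [sq_nonneg (m t)]) hn1.le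
    linarith
  have hbound : ∀ t, ε ≤ t → -(4 * δ) - φ ε + C / (b - 1) * (r₀ + ε) ^ (-(b - 1))
      ≤ C / (b - 1) * (r₀ + t) ^ (-(b - 1)) := by
    intro t ht
    have h1 := hanti (self_mem_Ici) (show t ∈ Ici ε from ht) ht
    have h2 := hlow t ht
    simp only at h1
    linarith
  have hlim : Filter.Tendsto (fun t : ℝ => C / (b - 1) * (r₀ + t) ^ (-(b - 1)))
      Filter.atTop (nhds (C / (b - 1) * 0)) :=
    ((tendsto_rpow_neg_atTop hb1).comp
      (Filter.tendsto_atTop_add_const_left _ r₀ Filter.tendsto_id)).const_mul _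
  have hfin := ge_of_tendsto hlim
    ((Filter.eventually_ge_atTop ε).mono hbound)
  have hP : 0 < (r₀ + ε) ^ (b - 1) := Real.rpow_pos_of_pos (by linarith) _
  rw [Real.rpow_neg (by linarith), mul_zero] at hfin
  have h3 : 4 * δ + ((n : ℝ) + 4 * δ * (ε + 1) - 1) / ε
      < C / (b - 1) * ((r₀ + ε) ^ (b - 1))⁻¹ := by
    rw [← div_eq_mul_inv, div_div, lt_div_iff₀ (by positivity)]
    linarith
  linarith
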